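/- Let Ω and Ω_i (i ∈ ℕ) be open bounded convex subsets of ℝ^n with cl(Ω_i) → cl(Ω) in the Hausdorff metric and cl(Ω_i) ⊂ Ω for every i. Let u be the torsion function of Ω. Let x ∈ ∂Ω be a point where ∇u has a finite nontangential limit and ∂Ω is differentiable, and let x_i ∈ ∂Ω_i converge nontangentially to x with ∂Ω_i differentiable at x_i for every i. Define ∇_T u(x_i) = ∇u(x_i) − ⟨∇u(x_i), ν_i(x_i)⟩ ν_i(x_i), where ν_i is the Gauss map of cl(Ω_i). Then ∇_T u(x_i) → 0 as i → ∞. -/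

import Mathlib

open MeasureTheory Metric Set Filter Bornology
open scoped Topology Pointwise RealInnerProductSpace ENNReal NNReal BigOperators Classical

noncomputable section

/-- Euclidean `n`-space. -/
abbrev Euc (n : ℕ) : Type := EuclideanSpace ℝ (Fin n)

variable {n : ℕ}

/-- The Laplacian of `u`, as the sum of the pure second derivatives in the coordinate
directions. -/
def lapl (u : Euc n → ℝ) (x : Euc n) : ℝ :=
  ∑ i : Fin n, iteratedFDeriv ℝ 2 u x (fun _ => EuclideanSpace.single i (1 : ℝ))

/-- `u` is the torsion function of `Ω`: the solution of `Δu = -2` in `Ω`, `u = 0` on `∂Ω`,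
continuous up to the boundary and smooth inside. -/
structure IsTorsionFunction (Ω : Set (Euc n)) (u : Euc n → ℝ) : Prop where
  continuousOn : ContinuousOn u (closure Ω)
  smooth : ContDiffOn ℝ (⊤ : ℕ∞) u Ω
  lapl_eq : ∀ x ∈ Ω, lapl u x = -2
  boundary_zero : ∀ x ∈ frontier Ω, u x = 0

/-- The torsional rigidity `τ(Ω) = ∫_Ω ‖∇u‖²` where `u` is the torsion function of `Ω`. -/
def torsionRigidity (Ω : Set (Euc n)) : ℝ :=
  if h : ∃ u, IsTorsionFunction Ω u then ∫ x in Ω, ‖gradient h.choose x‖ ^ 2 else 0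

/-- The nontangential cone `Γ_α(x̄) = {x ∈ Ω : |x - x̄| ≤ (1+α) dist(x, ∂Ω)}`. -/
def ntCone (Ω : Set (Euc n)) (x : Euc n) (α : ℝ) : Set (Euc n) :=
  {y ∈ Ω | dist y x ≤ (1 + α) * infDist y (frontier Ω)}

/-- `w` has nontangential limit `L` at the boundary point `x`. -/
def HasNTLimitAt {F : Type*} [TopologicalSpace F] (Ω : Set (Euc n)) (w : Euc n → F)
    (x : Euc n) (L : F) : Prop :=
  ∀ α > 0, Tendsto w (𝓝[ntCone Ω x α] x) (𝓝 L)

/-- The nontangential boundary values of `∇u` (junk value `0` where they do not exist). -/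
def ntGradient (Ω : Set (Euc n)) (u : Euc n → ℝ) (x : Euc n) : Euc n :=
  if h : ∃ L, HasNTLimitAt Ω (gradient u) x L then h.choose else 0

/-- `X` is an outer unit normal to `K` at `x`. -/
def IsOuterNormalAt (K : Set (Euc n)) (x X : Euc n) : Prop :=
  ‖X‖ = 1 ∧ ∀ y ∈ K, ⟪y, X⟫ ≤ ⟪x, X⟫

/-- The Gauss map of `K`: the outer unit normal at the points of `∂K` where it is unique
(i.e. where `∂K` is differentiable), junk value `0` elsewhere. -/
def gaussMap (K : Set (Euc n)) (x : Euc n) : Euc n :=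
  if h : ∃! X, IsOuterNormalAt K x X then h.choose else 0

/-- The support function of a set: `h_K(X) = sup_{y ∈ K} ⟨y, X⟩`. -/
def suppFn (K : Set (Euc n)) (X : Euc n) : ℝ :=
  sSup ((fun y => ⟪y, X⟫) '' K)

/-- The measure `μ_{τ,Ω}(η) = ∫_{ν⁻¹(η)} |∇u|² dH^{n-1}` (as a set function on Borel sets
`η ⊆ S^{n-1}`), where `ν` is the Gauss map and `∇u` is taken in the sense of nontangential
limits. -/
def torsionMeasure (Ω : Set (Euc n)) (u : Euc n → ℝ) (η : Set (Euc n)) : ℝ≥0∞ :=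
  ∫⁻ x in frontier Ω ∩ gaussMap (closure Ω) ⁻¹' η,
    ENNReal.ofReal (‖ntGradient Ω u x‖ ^ 2) ∂μH[(n : ℝ) - 1]

/-- The mixed torsional rigidity `τ₁(Ω, Ω') = ∫_{∂Ω} h_{Ω'}(ν(x)) ‖∇u(x)‖² dH^{n-1}(x)`. -/
def mixedTorsion (Ω Ω' : Set (Euc n)) : ℝ :=
  if h : ∃ u, IsTorsionFunction Ω u then
    ∫ x in frontier Ω,
      suppFn (closure Ω') (gaussMap (closure Ω) x) * ‖ntGradient Ω h.choose x‖ ^ 2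
        ∂μH[(n : ℝ) - 1]
  else 0

/-- The Alexandrov body `B[g] = {x : ⟨x, X⟩ ≤ g(X) for all X ∈ S^{n-1}}` of a positive
continuous function `g` on the sphere. -/
def alexandrovBody (g : Euc n → ℝ) : Set (Euc n) :=
  {x | ∀ X ∈ sphere (0 : Euc n) 1, ⟪x, X⟫ ≤ g X}

theorem hasDerivAt_comp_line {E F : Type*} [NormedAddCommGroup E] [NormedSpace ℝ E]
    [NormedAddCommGroup F] [NormedSpace ℝ F] {f : E → F} {x e : E} {t : ℝ}
    (hf : DifferentiableAt ℝ f (x + t • e)) :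
    HasDerivAt (fun s : ℝ => f (x + s • e)) (fderiv ℝ f (x + t • e) e) t := by
  have h : HasDerivAt (fun s : ℝ => x + s • e) e t := by
    simpa using ((hasDerivAt_id t).smul_const e).const_add x
  exact hf.hasFDerivAt.comp_hasDerivAt t h

/-- Second-order necessary condition at a local minimum. -/
theorem IsLocalMin.iteratedFDeriv_two_nonneg {E : Type*} [NormedAddCommGroup E]
    [NormedSpace ℝ E] {f : E → ℝ} {x : E} (hmin : IsLocalMin f x) (hf : ContDiffAt ℝ 2 f x)
    (e : E) : 0 ≤ iteratedFDeriv ℝ 2 f x (fun _ => e) := by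
  have hline : Tendsto (fun s : ℝ => x + s • e) (𝓝 0) (𝓝 x) := by
    have : Continuous (fun s : ℝ => x + s • e) := by fun_prop
    simpa using this.tendsto 0
  have hderiv : deriv (fun s : ℝ => f (x + s • e)) =ᶠ[𝓝 0]
      fun s => fderiv ℝ f (x + s • e) e := by
    filter_upwards [hline.eventually (hf.eventually (by simp))] with s hs
    exact (hasDerivAt_comp_line (hs.differentiableAt (by simp))).deriv
  have hdd : deriv (deriv (fun s : ℝ => f (x + s • e))) 0 =
      iteratedFDeriv ℝ 2 f x (fun _ => e) := by
    have h1 : DifferentiableAt ℝ (fderiv ℝ f) (x + (0 : ℝ) • e) := by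
      simpa using (hf.fderiv_right (m := 1) (by norm_num)).differentiableAt (by simp)
    have h2 := ((hasDerivAt_comp_line h1).clm_apply (hasDerivAt_const (0 : ℝ) e)).deriv
    rw [hderiv.deriv_eq, h2, iteratedFDeriv_two_apply]
    simp
  have hmin' : IsLocalMin (fun s : ℝ => f (x + s • e)) 0 := by
    simpa [IsLocalMin, IsMinFilter] using hline.eventually hmin
  have hcont : ContinuousAt (fun s : ℝ => f (x + s • e)) 0 := by
    have : ContinuousAt f (x + (0 : ℝ) • e) := by simpa using hf.continuousAt
    exact ContinuousAt.comp this (by fun_prop)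
  by_contra! hneg
  have hmax := isLocalMax_of_deriv_deriv_neg (by rwa [hdd]) hmin'.deriv_eq_zero hcont
  have hconst : (fun s : ℝ => f (x + s • e)) =ᶠ[𝓝 0] fun _ => f (x + (0 : ℝ) • e) := by
    filter_upwards [hmin', hmax] with s h1 h2
    exact le_antisymm h2 h1
  have := hconst.deriv.deriv_eq
  simp only [deriv_const', deriv_const] at this
  linarith

theorem IsTorsionFunction.contDiffAt {Ω : Set (Euc n)} {u : Euc n → ℝ}
    (hu : IsTorsionFunction Ω u) (hΩ : IsOpen Ω) {y : Euc n} (hy : y ∈ Ω) :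
    ContDiffAt ℝ (⊤ : ℕ∞) u y :=
  hu.smooth.contDiffAt (hΩ.mem_nhds hy)

/-- The torsion function is nonnegative, by the minimum principle. -/
theorem IsTorsionFunction.nonneg {Ω : Set (Euc n)} {u : Euc n → ℝ}
    (hu : IsTorsionFunction Ω u) (hΩo : IsOpen Ω) (hΩb : IsBounded Ω) {y : Euc n}
    (hy : y ∈ closure Ω) : 0 ≤ u y := by
  obtain ⟨z, hz, hmin⟩ := hΩb.isCompact_closure.exists_isMinOn ⟨y, hy⟩ hu.continuousOn
  suffices hz' : z ∈ frontier Ω by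
    rw [← hu.boundary_zero z hz']
    exact hmin hy
  rw [hΩo.frontier_eq]
  refine ⟨hz, fun hzΩ => ?_⟩
  have hloc : IsLocalMin u z := by
    filter_upwards [hΩo.mem_nhds hzΩ] with w hw
    exact hmin (subset_closure hw)
  have h2 : ContDiffAt ℝ 2 u z := (hu.contDiffAt hΩo hzΩ).of_le (by norm_cast)
  have hlap : 0 ≤ lapl u z := Finset.sum_nonneg fun i _ => hloc.iteratedFDeriv_two_nonneg h2 _
  rw [hu.lapl_eq z hzΩ] at hlap
  norm_num at hlap

theorem le_infDist_frontier_of_ball_subset {Ω : Set (Euc n)} (hΩo : IsOpen Ω)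
    (hne : (frontier Ω).Nonempty) {y : Euc n} {r : ℝ} (h : ball y r ⊆ Ω) :
    r ≤ infDist y (frontier Ω) := by
  rw [le_infDist hne]
  intro z hz
  rw [hΩo.frontier_eq] at hz
  by_contra! hlt
  exact hz.2 (h (by rwa [mem_ball, dist_comm]))

/-- At a boundary point with a unique outer normal `ν`, each direction `e` with `⟪e, ν⟫ < 0`
points into the interior. -/
theorem exists_add_smul_mem_of_inner_neg {Ω : Set (Euc n)} (hΩo : IsOpen Ω)
    (hΩc : Convex ℝ Ω) (hΩne : Ω.Nonempty) {x : Euc n} (hx : x ∈ closure Ω) {ν : Euc n}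
    (huniq : ∀ X, IsOuterNormalAt (closure Ω) x X → X = ν) {e : Euc n} (he : ⟪e, ν⟫ < 0) :
    ∃ r : ℝ, 0 < r ∧ x + r • e ∈ Ω := by
  by_contra! hray
  set T : Set (Euc n) := (fun r : ℝ => x + r • e) '' Ioi 0 with hT
  have hTc : Convex ℝ T := by
    rintro _ ⟨r, hr, rfl⟩ _ ⟨s, hs, rfl⟩ a b ha hb hab
    refine ⟨a * r + b * s, (convex_Ioi (0 : ℝ)) hr hs ha hb hab, ?_⟩
    have : x = (a + b) • x := by rw [hab, one_smul]
    simp only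
    nth_rewrite 1 [this]
    module
  have hdisj : Disjoint Ω T := by
    rw [Set.disjoint_right]
    rintro _ ⟨r, hr, rfl⟩
    exact hray r hr
  obtain ⟨f, s, hfΩ, hfT⟩ := geometric_hahn_banach_open hΩc hΩo hTc hdisj
  have hcl : ∀ y ∈ closure Ω, f y ≤ s := fun y hy =>
    closure_minimal (fun a ha => (hfΩ a ha).le) (isClosed_le f.continuous continuous_const) hy
  have hsx : s ≤ f x := by
    have hlim : Tendsto (fun r : ℝ => f (x + r • e)) (𝓝[>] 0) (𝓝 (f x)) := by
      have : Continuous (fun r : ℝ => f (x + r • e)) := by fun_prop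
      simpa using (this.tendsto 0).mono_left nhdsWithin_le_nhds
    exact ge_of_tendsto hlim (eventually_nhdsWithin_of_forall fun r hr => hfT _ ⟨r, hr, rfl⟩)
  have hfe : 0 ≤ f e := by
    have := hfT _ ⟨1, by simp, rfl⟩
    simp only [one_smul, map_add] at this
    linarith [hcl x hx]
  set w : Euc n := (InnerProductSpace.toDual ℝ (Euc n)).symm f with hw
  have hfw : ∀ y, f y = ⟪y, w⟫ := fun y => by
    rw [real_inner_comm, hw, InnerProductSpace.toDual_symm_apply]
  have hw0 : w ≠ 0 := by
    intro h0
    obtain ⟨a, ha⟩ := hΩne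
    have h1 := hfΩ a ha
    rw [hfw, h0, inner_zero_right] at h1
    rw [hfw, h0, inner_zero_right] at hsx
    linarith
  have hwpos : 0 < ‖w‖ := norm_pos_iff.2 hw0
  have hnormal : IsOuterNormalAt (closure Ω) x (‖w‖⁻¹ • w) := by
    refine ⟨norm_smul_inv_norm hw0, fun y hy => ?_⟩
    rw [inner_smul_right, inner_smul_right, ← hfw, ← hfw]
    exact mul_le_mul_of_nonneg_left ((hcl y hy).trans hsx) (inv_nonneg.2 hwpos.le)
  rw [← huniq _ hnormal, inner_smul_right, ← hfw] at he
  exact absurd he (not_lt.2 (mul_nonneg (inv_nonneg.2 hwpos.le) hfe))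

/-- A segment from a boundary point into the interior approaches its end point
nontangentially. -/
theorem exists_segment_mem_ntCone {Ω : Set (Euc n)} (hΩo : IsOpen Ω) (hΩc : Convex ℝ Ω)
    {x : Euc n} (hx : x ∈ frontier Ω) {e : Euc n} {r₀ : ℝ} (hr₀ : 0 < r₀)
    (hmem : x + r₀ • e ∈ Ω) :
    ∃ α > 0, ∀ r ∈ Ioc 0 r₀, x + r • e ∈ ntCone Ω x α := by
  obtain ⟨c, hc, hball⟩ := Metric.isOpen_iff.1 hΩo _ hmem
  have hscale : ∀ r ∈ Ioc 0 r₀, ball (x + r • e) (c * r / r₀) ⊆ Ω := by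
    intro r hr y hy
    have hrpos : 0 < r := hr.1
    set z : Euc n := x + (r₀ / r) • (y - x) with hz
    have hzΩ : z ∈ Ω := by
      apply hball
      have hsub : z - (x + r₀ • e) = (r₀ / r) • (y - (x + r • e)) := by
        have : r₀ • e = (r₀ / r) • (r • e) := by
          rw [smul_smul, div_mul_cancel₀ _ hrpos.ne']
        rw [hz, this]
        module
      rw [mem_ball, dist_eq_norm, hsub, norm_smul, Real.norm_of_nonneg (by positivity)]
      rw [mem_ball, dist_eq_norm] at hy
      calc r₀ / r * ‖y - (x + r • e)‖ < r₀ / r * (c * r / r₀) := by gcongr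
        _ = c := by field_simp
    have hyz : y = (1 - r / r₀) • x + (r / r₀) • z := by
      have : (r / r₀) * (r₀ / r) = 1 := by field_simp
      rw [hz, smul_add, smul_smul, this]
      module
    have := hΩc.combo_closure_interior_mem_interior (frontier_subset_closure hx)
      (by rwa [hΩo.interior_eq]) (sub_nonneg.2 ((div_le_one hr₀).2 hr.2))
      (div_pos hrpos hr₀) (sub_add_cancel 1 (r / r₀))
    rwa [hΩo.interior_eq, ← hyz] at this
  refine ⟨r₀ * (‖e‖ + 1) / c, by positivity, fun r hr => ?_⟩
  have hrpos : 0 < r := hr.1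
  refine ⟨hscale r hr (mem_ball_self (by positivity)), ?_⟩
  have hdist := le_infDist_frontier_of_ball_subset hΩo ⟨x, hx⟩ (hscale r hr)
  calc dist (x + r • e) x = r * ‖e‖ := by
        simp [dist_eq_norm, norm_smul, abs_of_pos hrpos]
    _ ≤ r * (‖e‖ + 1) + c * r / r₀ := by
        have : 0 ≤ c * r / r₀ := by positivity
        nlinarith
    _ = (1 + r₀ * (‖e‖ + 1) / c) * (c * r / r₀) := by field_simp; ring
    _ ≤ _ := by gcongr

/-- The nontangential limit of `∇u` pairs nonnegatively with every inward direction. -/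
theorem IsTorsionFunction.inner_ntLimit_nonneg {Ω : Set (Euc n)} {u : Euc n → ℝ}
    (hu : IsTorsionFunction Ω u) (hΩo : IsOpen Ω) (hΩb : IsBounded Ω) (hΩc : Convex ℝ Ω)
    {x L : Euc n} (hx : x ∈ frontier Ω) (hL : HasNTLimitAt Ω (gradient u) x L)
    {e : Euc n} {r₀ : ℝ} (hr₀ : 0 < r₀) (hmem : x + r₀ • e ∈ Ω) : 0 ≤ ⟪L, e⟫ := by
  by_contra! hneg
  obtain ⟨α, hα, hcone⟩ := exists_segment_mem_ntCone hΩo hΩc hx hr₀ hmem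
  have hcont : Continuous (fun r : ℝ => x + r • e) := by fun_prop
  have hline : Tendsto (fun r : ℝ => x + r • e) (𝓝[>] 0) (𝓝[ntCone Ω x α] x) := by
    refine tendsto_nhdsWithin_iff.2 ⟨?_, ?_⟩
    · simpa using (hcont.tendsto 0).mono_left nhdsWithin_le_nhds
    · filter_upwards [Ioc_mem_nhdsGT hr₀] with r hr using hcone r hr
  have hlim : Tendsto (fun r : ℝ => ⟪gradient u (x + r • e), e⟫) (𝓝[>] 0) (𝓝 ⟪L, e⟫) :=
    ((hL α hα).comp hline).inner tendsto_const_nhds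
  obtain ⟨δ, hδ, hlt⟩ :=
    (mem_nhdsGT_iff_exists_Ioc_subset).1 (hlim.eventually_lt_const hneg)
  have hδ : 0 < δ := hδ
  set ρ := min δ r₀ with hρ
  have hρpos : 0 < ρ := lt_min hδ hr₀
  have hin : ∀ r ∈ Ioc 0 ρ, x + r • e ∈ Ω := fun r hr =>
    (hcone r ⟨hr.1, hr.2.trans (min_le_right _ _)⟩).1
  have hmaps : MapsTo (fun r : ℝ => x + r • e) (Icc 0 ρ) (closure Ω) := by
    intro r hr
    rcases hr.1.eq_or_lt with rfl | h
    · simpa using frontier_subset_closure hx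
    · exact subset_closure (hin r ⟨h, hr.2⟩)
  have hanti : StrictAntiOn (fun r : ℝ => u (x + r • e)) (Icc 0 ρ) := by
    refine strictAntiOn_of_deriv_neg (convex_Icc _ _)
      (hu.continuousOn.comp hcont.continuousOn hmaps) fun r hr => ?_
    rw [interior_Icc] at hr
    have hd := (hu.contDiffAt hΩo (hin r ⟨hr.1, hr.2.le⟩)).differentiableAt (by simp)
    rw [(hasDerivAt_comp_line hd).deriv, ← inner_gradient_left]
    exact hlt ⟨hr.1, hr.2.le.trans (min_le_left _ _)⟩
  have h1 := hanti (left_mem_Icc.2 hρpos.le) (right_mem_Icc.2 hρpos.le) hρpos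
  have h2 := hu.nonneg hΩo hΩb (hmaps (right_mem_Icc.2 hρpos.le))
  simp only [zero_smul, add_zero, hu.boundary_zero x hx] at h1
  exact absurd h1 (not_lt.2 h2)

/-- The nontangential limit of `∇u` at a differentiability point of `∂Ω` is normal. -/
theorem IsTorsionFunction.ntLimit_eq_smul_normal {Ω : Set (Euc n)} {u : Euc n → ℝ}
    (hu : IsTorsionFunction Ω u) (hΩo : IsOpen Ω) (hΩb : IsBounded Ω) (hΩc : Convex ℝ Ω)
    (hΩne : Ω.Nonempty) {x L : Euc n} (hx : x ∈ frontier Ω)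
    (hL : HasNTLimitAt Ω (gradient u) x L) {ν : Euc n} (hν : ‖ν‖ = 1)
    (huniq : ∀ X, IsOuterNormalAt (closure Ω) x X → X = ν) : L - ⟪L, ν⟫ • ν = 0 := by
  have hinward : ∀ e : Euc n, ⟪e, ν⟫ < 0 → 0 ≤ ⟪L, e⟫ := fun e he => by
    obtain ⟨r, hr, hmem⟩ :=
      exists_add_smul_mem_of_inner_neg hΩo hΩc hΩne (frontier_subset_closure hx) huniq he
    exact hu.inner_ntLimit_nonneg hΩo hΩb hΩc hx hL hr hmem
  have hνν : ⟪ν, ν⟫ = 1 := by rw [real_inner_self_eq_norm_sq, hν, one_pow]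
  set t : Euc n := L - ⟪L, ν⟫ • ν with ht
  have htν : ⟪t, ν⟫ = 0 := by
    rw [ht, inner_sub_left, inner_smul_left, hνν]
    simp
  have hLt : ⟪L, t⟫ = ⟪t, t⟫ := by
    have : L = t + ⟪L, ν⟫ • ν := by rw [ht]; module
    nth_rewrite 1 [this]
    rw [inner_add_left, inner_smul_left, real_inner_comm t ν, htν, mul_zero, add_zero]
  have hlim : Tendsto (fun ε : ℝ => ⟪L, -t - ε • ν⟫) (𝓝[>] 0) (𝓝 ⟪L, -t⟫) := by
    have : Continuous (fun ε : ℝ => ⟪L, -t - ε • ν⟫) := by fun_prop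
    simpa using (this.tendsto 0).mono_left nhdsWithin_le_nhds
  have hge : 0 ≤ ⟪L, -t⟫ := by
    refine ge_of_tendsto hlim (eventually_nhdsWithin_of_forall fun ε hε => hinward _ ?_)
    rw [inner_sub_left, inner_neg_left, inner_smul_left, htν, hνν]
    simpa using hε
  rw [inner_neg_right, hLt] at hge
  exact inner_self_eq_zero.1 (le_antisymm (by linarith) real_inner_self_nonneg)

theorem isOuterNormalAt_gaussMap {K : Set (Euc n)} {x : Euc n}
    (h : ∃! X, IsOuterNormalAt K x X) : IsOuterNormalAt K x (gaussMap K x) := by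
  rw [gaussMap, dif_pos h]
  exact h.choose_spec.1

/-- Outer unit normals of converging bodies converge to the normal at a point where the latter
is unique. -/
theorem tendsto_outerNormal {K : Set (Euc n)} {Ks : ℕ → Set (Euc n)} (hKb : IsBounded K)
    (hKne : K.Nonempty) (hKs : ∀ i, IsBounded (Ks i) ∧ (Ks i).Nonempty)
    (hconv : Tendsto (fun i => hausdorffDist (Ks i) K) atTop (𝓝 0))
    {x : Euc n} {xs : ℕ → Euc n} (hxc : Tendsto xs atTop (𝓝 x)) {νs : ℕ → Euc n}
    (hνs : ∀ i, IsOuterNormalAt (Ks i) (xs i) (νs i)) {ν : Euc n}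
    (huniq : ∀ X, IsOuterNormalAt K x X → X = ν) : Tendsto νs atTop (𝓝 ν) := by
  refine (isCompact_sphere (0 : Euc n) 1).tendsto_nhds_of_unique_mapClusterPt
    (Eventually.of_forall fun i => by simpa using (hνs i).1) fun X hX hclus => huniq X ?_
  refine ⟨by simpa using hX, fun y hy => ?_⟩
  suffices h : ⟪y - x, X⟫ ≤ 0 by
    rw [inner_sub_left] at h
    linarith
  refine le_of_forall_pos_le_add fun ε hε => ?_
  have hev : ∀ᶠ i in atTop, νs i ∈ {Z : Euc n | ⟪y - x, Z⟫ ≤ 0 + ε} := by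
    filter_upwards [hconv.eventually_lt_const (half_pos hε),
      Metric.tendsto_nhds.1 hxc _ (half_pos hε)] with i hi hxi
    obtain ⟨z, hz, hzy⟩ := exists_dist_lt_of_hausdorffDist_lt' hy hi
      (hausdorffEDist_ne_top_of_nonempty_of_bounded (hKs i).2 hKne (hKs i).1 hKb)
    have h1 := (hνs i).2 z hz
    have h2 : ⟪(y - z) + (xs i - x), νs i⟫ ≤ ‖(y - z) + (xs i - x)‖ * ‖νs i‖ :=
      real_inner_le_norm _ _
    rw [(hνs i).1, mul_one] at h2
    have h3 := norm_add_le (y - z) (xs i - x)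
    rw [← dist_eq_norm, ← dist_eq_norm, dist_comm y z] at h3
    have h4 : ⟪y - x, νs i⟫ = ⟪(y - z) + (xs i - x), νs i⟫ + (⟪z, νs i⟫ - ⟪xs i, νs i⟫) := by
      simp only [inner_sub_left, inner_add_left]
      ring
    change ⟪y - x, νs i⟫ ≤ 0 + ε
    rw [h4]
    linarith
  have hclosed : IsClosed {Z : Euc n | ⟪y - x, Z⟫ ≤ 0 + ε} :=
    isClosed_le (by fun_prop) continuous_const
  exact hclosed.mem_of_mapClusterPt hclus hev

/-- Vanishing of tangential gradients: with `cl(Ω_i) ⊆ Ω` converging to `cl(Ω)` in the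
Hausdorff metric and `x_i ∈ ∂Ω_i` converging nontangentially to `x ∈ ∂Ω`, the tangential
component `∇_T u(x_i) = ∇u(x_i) - ⟨∇u(x_i), ν_i(x_i)⟩ ν_i(x_i)` tends to `0`. -/
theorem tendsto_tangential_gradient (Ω : Set (Euc n)) (Ωs : ℕ → Set (Euc n))
    (hΩo : IsOpen Ω) (hΩb : IsBounded Ω) (hΩc : Convex ℝ Ω) (hΩne : Ω.Nonempty)
    (hΩs : ∀ i, IsOpen (Ωs i) ∧ IsBounded (Ωs i) ∧ Convex ℝ (Ωs i) ∧ (Ωs i).Nonempty)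
    (hconv : Tendsto (fun i => hausdorffDist (closure (Ωs i)) (closure Ω)) atTop (𝓝 0))
    (hsub : ∀ i, closure (Ωs i) ⊆ Ω)
    (u : Euc n → ℝ) (hu : IsTorsionFunction Ω u)
    (x : Euc n) (hx : x ∈ frontier Ω)
    (hntlim : ∃ L : Euc n, HasNTLimitAt Ω (gradient u) x L)
    (hdx : ∃! X, IsOuterNormalAt (closure Ω) x X)
    (xs : ℕ → Euc n) (hxs : ∀ i, xs i ∈ frontier (Ωs i))
    (hdxs : ∀ i, ∃! X, IsOuterNormalAt (closure (Ωs i)) (xs i) X)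
    (hxc : Tendsto xs atTop (𝓝 x))
    (hnt : ∃ α > 0, ∀ i, xs i ∈ ntCone Ω x α) :
    Tendsto (fun i =>
        gradient u (xs i) -
          ⟪gradient u (xs i), gaussMap (closure (Ωs i)) (xs i)⟫ •
            gaussMap (closure (Ωs i)) (xs i))
      atTop (𝓝 0) := by
  obtain ⟨L, hL⟩ := hntlim
  obtain ⟨α, hα, hcone⟩ := hnt
  obtain ⟨ν, hν, huniq⟩ := hdx
  have hgrad : Tendsto (fun i => gradient u (xs i)) atTop (𝓝 L) :=
    (hL α hα).comp (tendsto_nhdsWithin_iff.2 ⟨hxc, Eventually.of_forall hcone⟩)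
  have hnormal : Tendsto (fun i => gaussMap (closure (Ωs i)) (xs i)) atTop (𝓝 ν) :=
    tendsto_outerNormal hΩb.closure hΩne.closure
      (fun i => ⟨(hΩs i).2.1.closure, (hΩs i).2.2.2.closure⟩) hconv hxc
      (fun i => isOuterNormalAt_gaussMap (hdxs i)) huniq
  rw [← hu.ntLimit_eq_smul_normal hΩo hΩb hΩc hΩne hx hL hν.1 huniq]
  exact hgrad.sub ((hgrad.inner hnormal).smul hnormal)

end
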